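/- arXiv:2403.15184 — 5 statements merged into one kernel-verified Lean document; each statement's English description precedes it below -/
import Mathlib

section
/- Under these hypotheses, if moreover a ≤ 1/4 and a + c_r ≤ 1/4, then for every integer k ≥ 1, every n ∈ ℕ and every f ∈ F one has p_n(L^k f) ≤ 4^{−k} · p_n(f) + 4 · c_n · k · 4^{−k} · p_r(f). (This is the geometric decay estimate for the iterates of L established in the proof of Proposition A.4 of the paper.) -/
/-- Geometric decay estimate for the iterates of `L` (from the proof of Proposition A.4):
if `a ≤ 1/4` and `a + c_r ≤ 1/4`, then
`p_n (L^k f) ≤ 4^{-k} p_n f + 4 c_n k 4^{-k} p_r f`. -/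
theorem geometric_decay {F : Type*} [AddCommGroup F] [Module ℝ F]
    (p : ℕ → Seminorm ℝ F) (L : F →ₗ[ℝ] F) (r : ℕ) (a : ℝ) (ha : 0 ≤ a)
    (c : ℕ → ℝ) (hc : ∀ n, 0 ≤ c n)
    (hL : ∀ (n : ℕ) (f : F), p n (L f) ≤ a * p n f + c n * p r f)
    (ha4 : a ≤ 1 / 4) (hac : a + c r ≤ 1 / 4) :
    ∀ (k : ℕ), 1 ≤ k → ∀ (n : ℕ) (f : F),
      p n ((L ^ k) f) ≤ (1 / 4 : ℝ) ^ k * p n f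
        + 4 * c n * k * (1 / 4 : ℝ) ^ k * p r f := by
  have hr : ∀ (k : ℕ) (f : F), p r ((L ^ k) f) ≤ (1 / 4 : ℝ) ^ k * p r f := by
    intro k f
    induction k with
    | zero => simp
    | succ k ih =>
      rw [pow_succ' L, Module.End.mul_apply, pow_succ]
      have h1 := hL r ((L ^ k) f)
      have h2 := mul_le_mul_of_nonneg_right hac (apply_nonneg (p r) ((L ^ k) f))
      linarith
  have key : ∀ (k : ℕ) (n : ℕ) (f : F),
      p n ((L ^ k) f) ≤ (1 / 4 : ℝ) ^ k * p n f
        + 4 * c n * k * (1 / 4 : ℝ) ^ k * p r f := by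
    intro k n f
    induction k with
    | zero => simp
    | succ k ih =>
      rw [pow_succ' L, Module.End.mul_apply, pow_succ]
      push_cast
      have h1 := hL n ((L ^ k) f)
      have h2 := mul_le_mul_of_nonneg_right ha4 (apply_nonneg (p n) ((L ^ k) f))
      have h3 := mul_le_mul_of_nonneg_left (hr k f) (hc n)
      linarith
  intro k _ n f
  exact key k n f
end

section
/- Suppose K : E → F is tame of order r with data (r_0, (D_n)), L : F → G is μ-tamely small of order t with datum r_1, and μ_{r_2} ≤ M, where r_2 = max(r_1, t + r_0) and M ≥ 0. Then L ∘ K : E → G is μ-tamely small of order r + t with datum r_2: for every n ∈ ℕ and every ε > 0 there is a constant C such that s_n(L(K f)) ≤ ε·μ_{r_2}·p_{n+r+t}(f) + C·μ_{n+r_2}·p_{r+t}(f) for all f ∈ E. (Lemma A.3(i) of the paper.) -/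
/-- Lemma A.3(i): the composite of a tame map `K` (of order `r`, data `(r₀, D)`) with a
`μ`-tamely small map `L` (of order `t`, datum `r₁`) is `μ`-tamely small of order `r + t`
with datum `r₂ = max r₁ (t + r₀)`, provided `μ_{r₂} ≤ M`. -/
theorem tame_comp_tamelySmall {E F G : Type*}
    [AddCommGroup E] [Module ℝ E] [AddCommGroup F] [Module ℝ F]
    [AddCommGroup G] [Module ℝ G]
    (p : ℕ → Seminorm ℝ E) (q : ℕ → Seminorm ℝ F) (s : ℕ → Seminorm ℝ G)
    (hpmono : ∀ (n : ℕ) (f : E), p n f ≤ p (n + 1) f)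
    (hqmono : ∀ (n : ℕ) (g : F), q n g ≤ q (n + 1) g)
    (hsmono : ∀ (n : ℕ) (g : G), s n g ≤ s (n + 1) g)
    (μ : ℕ → ℝ) (hμ : ∀ n, 0 ≤ μ n) (hμmono : Monotone μ)
    (K : E →ₗ[ℝ] F) (L : F →ₗ[ℝ] G)
    (r r₀ : ℕ) (D : ℕ → ℝ)
    (hK : ∀ (n : ℕ) (f : E),
      q n (K f) ≤ D n * (p (n + r) f + (1 + μ (n + r₀)) * p r f))
    (t r₁ : ℕ)
    (hL : ∀ (n : ℕ), ∀ ε > (0 : ℝ), ∃ C : ℝ, ∀ g : F,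
      s n (L g) ≤ ε * μ r₁ * q (n + t) g + C * μ (n + r₁) * q t g)
    (M : ℝ) (hM : 0 ≤ M) (hμM : μ (max r₁ (t + r₀)) ≤ M) :
    ∀ (n : ℕ), ∀ ε > (0 : ℝ), ∃ C : ℝ, ∀ f : E,
      s n (L (K f)) ≤ ε * μ (max r₁ (t + r₀)) * p (n + (r + t)) f
        + C * μ (n + max r₁ (t + r₀)) * p (r + t) f := by
  intro n ε hε
  have ha : 0 ≤ |D (n + t)| := abs_nonneg _
  have hb : 0 ≤ |D t| := abs_nonneg _
  obtain ⟨C, hC⟩ := hL n (ε / (|D (n + t)| + 1)) (by positivity)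
  have hc : 0 ≤ |C| := abs_nonneg _
  refine ⟨ε * (1 + M) + |C| * (|D t| * (2 + M)), fun f => ?_⟩
  have hpm : Monotone (fun k => p k f) := monotone_nat_of_le_succ (fun k => hpmono k f)
  have h0 := hC (K f)
  have h1 := hK (n + t) f
  have h2 := hK t f
  rw [show n + t + r = n + (r + t) by omega] at h1
  rw [show t + r = r + t by omega] at h2
  have hpr : p r f ≤ p (r + t) f := hpm (by omega)
  have hp0 : 0 ≤ p r f := apply_nonneg _ _
  have hp1 : 0 ≤ p (r + t) f := apply_nonneg _ _
  have hp2 : 0 ≤ p (n + (r + t)) f := apply_nonneg _ _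
  have hq1 : 0 ≤ q (n + t) (K f) := apply_nonneg _ _
  have hq2 : 0 ≤ q t (K f) := apply_nonneg _ _
  have m1 : μ r₁ ≤ μ (max r₁ (t + r₀)) := hμmono (by omega)
  have m2 : μ (t + r₀) ≤ M := (hμmono (by omega)).trans hμM
  have m3 : μ (n + t + r₀) ≤ μ (n + max r₁ (t + r₀)) := hμmono (by omega)
  have m4 : μ (n + r₁) ≤ μ (n + max r₁ (t + r₀)) := hμmono (by omega)
  have m5 : μ r₁ ≤ μ (n + max r₁ (t + r₀)) := hμmono (by omega)
  have m6 : μ r₁ ≤ M := m1.trans hμM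
  have n1 := hμ r₁
  have n2 := hμ (t + r₀)
  have n3 := hμ (n + t + r₀)
  have n4 := hμ (n + r₁)
  have n5 := hμ (n + max r₁ (t + r₀))
  have n6 := hμ (max r₁ (t + r₀))
  generalize max r₁ (t + r₀) = R at *
  have hea : ε / (|D (n + t)| + 1) * |D (n + t)| ≤ ε := by
    rw [div_mul_eq_mul_div, div_le_iff₀ (by positivity)]
    nlinarith
  have he0 : 0 ≤ ε / (|D (n + t)| + 1) := by positivity
  generalize ε / (|D (n + t)| + 1) = e at *
  have k1 : q (n + t) (K f) ≤
      |D (n + t)| * (p (n + (r + t)) f + (1 + μ (n + t + r₀)) * p r f) :=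
    h1.trans (mul_le_mul_of_nonneg_right (le_abs_self _) (by positivity))
  have k2 : q t (K f) ≤ |D t| * ((2 + M) * p (r + t) f) := by
    refine h2.trans ((mul_le_mul_of_nonneg_right (le_abs_self _) (by positivity)).trans ?_)
    refine mul_le_mul_of_nonneg_left ?_ hb
    have : (1 + μ (t + r₀)) * p r f ≤ (1 + M) * p (r + t) f := by gcongr
    linarith
  have k3 : C * μ (n + r₁) * q t (K f) ≤
      |C| * μ (n + R) * (|D t| * ((2 + M) * p (r + t) f)) := by
    have : C * μ (n + r₁) ≤ |C| * μ (n + R) :=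
      mul_le_mul (le_abs_self _) m4 n4 hc
    exact mul_le_mul this k2 hq2 (by positivity)
  have k4 : μ r₁ * (1 + μ (n + t + r₀)) ≤ (1 + M) * μ (n + R) := by
    have : μ r₁ * μ (n + t + r₀) ≤ M * μ (n + R) := mul_le_mul m6 m3 n3 hM
    linarith
  have k5 : μ r₁ * (p (n + (r + t)) f + (1 + μ (n + t + r₀)) * p r f) ≤
      μ R * p (n + (r + t)) f + (1 + M) * μ (n + R) * p (r + t) f := by
    have u1 := mul_le_mul_of_nonneg_right m1 hp2
    have u2 := mul_le_mul k4 hpr hp0 (by positivity)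
    linarith
  have k6 : e * μ r₁ * q (n + t) (K f) ≤
      ε * (μ R * p (n + (r + t)) f + (1 + M) * μ (n + R) * p (r + t) f) := by
    calc e * μ r₁ * q (n + t) (K f)
        ≤ e * μ r₁ *
          (|D (n + t)| * (p (n + (r + t)) f + (1 + μ (n + t + r₀)) * p r f)) :=
          mul_le_mul_of_nonneg_left k1 (by positivity)
      _ = (e * |D (n + t)|) *
          (μ r₁ * (p (n + (r + t)) f + (1 + μ (n + t + r₀)) * p r f)) := by ring
      _ ≤ _ := mul_le_mul hea k5 (by positivity) hε.le
  linarith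
end

section
/- Suppose K : E → F is μ-tamely small of order r with datum r_1, L : F → G is tame of order t with data (t_0, (D_n)), and μ_{r_2} ≤ M, where r_2 = max(t_0, t + r_1) and M ≥ 0. Then L ∘ K : E → G is μ-tamely small of order r + t with datum r_2: for every n ∈ ℕ and every ε > 0 there is a constant C such that s_n(L(K f)) ≤ ε·μ_{r_2}·p_{n+r+t}(f) + C·μ_{n+r_2}·p_{r+t}(f) for all f ∈ E. (Lemma A.3(ii) of the paper.) -/
/-- Lemma A.3(ii): the composite of a `μ`-tamely small map `K` (of order `r`, datum `r₁`)
with a tame map `L` (of order `t`, data `(t₀, D)`) is `μ`-tamely small of order `r + t`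
with datum `r₂ = max t₀ (t + r₁)`, provided `μ_{r₂} ≤ M`. -/
theorem tamelySmall_comp_tame {E F G : Type*}
    [AddCommGroup E] [Module ℝ E] [AddCommGroup F] [Module ℝ F]
    [AddCommGroup G] [Module ℝ G]
    (p : ℕ → Seminorm ℝ E) (q : ℕ → Seminorm ℝ F) (s : ℕ → Seminorm ℝ G)
    (hpmono : ∀ (n : ℕ) (f : E), p n f ≤ p (n + 1) f)
    (hqmono : ∀ (n : ℕ) (g : F), q n g ≤ q (n + 1) g)
    (hsmono : ∀ (n : ℕ) (g : G), s n g ≤ s (n + 1) g)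
    (μ : ℕ → ℝ) (hμ : ∀ n, 0 ≤ μ n) (hμmono : Monotone μ)
    (K : E →ₗ[ℝ] F) (L : F →ₗ[ℝ] G)
    (r r₁ : ℕ)
    (hK : ∀ (n : ℕ), ∀ ε > (0 : ℝ), ∃ C : ℝ, ∀ f : E,
      q n (K f) ≤ ε * μ r₁ * p (n + r) f + C * μ (n + r₁) * p r f)
    (t t₀ : ℕ) (D : ℕ → ℝ)
    (hL : ∀ (n : ℕ) (g : F),
      s n (L g) ≤ D n * (q (n + t) g + (1 + μ (n + t₀)) * q t g))
    (M : ℝ) (hM : 0 ≤ M) (hμM : μ (max t₀ (t + r₁)) ≤ M) :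
    ∀ (n : ℕ), ∀ ε > (0 : ℝ), ∃ C : ℝ, ∀ f : E,
      s n (L (K f)) ≤ ε * μ (max t₀ (t + r₁)) * p (n + (r + t)) f
        + C * μ (n + max t₀ (t + r₁)) * p (r + t) f := by
  intro n ε hε
  have hpm : ∀ f : E, Monotone fun n => p n f := fun f => monotone_nat_of_le_succ fun n => hpmono n f
  set R := max t₀ (t + r₁) with hR
  have hR0 : t₀ ≤ R := le_max_left _ _
  have hR1 : t + r₁ ≤ R := le_max_right _ _
  have hD : 0 < |D n| + 1 := by positivity
  obtain ⟨C1, h1⟩ := hK (n + t) (ε / (|D n| + 1)) (by positivity)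
  obtain ⟨C2, h2⟩ := hK t 1 one_pos
  refine ⟨(|D n| + 1) * (|C1| + (1 + |C2|) * (1 + M)), fun f => ?_⟩
  have hP : 0 ≤ p (r + t) f := apply_nonneg _ _
  have hpr : p r f ≤ p (r + t) f := hpm f (by omega)
  have hpr0 : 0 ≤ p r f := apply_nonneg _ _
  have hPn : 0 ≤ p (n + (r + t)) f := apply_nonneg _ _
  have m1 : μ r₁ ≤ μ R := hμmono (by omega)
  have m2 : μ (t + r₁) ≤ μ R := hμmono hR1
  have m3 : μ (n + t + r₁) ≤ μ (n + R) := hμmono (by omega)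
  have m4 : μ (n + t₀) ≤ μ (n + R) := hμmono (by omega)
  have m5 : μ R ≤ μ (n + R) := hμmono (by omega)
  have hμR := hμ R
  have hμnR := hμ (n + R)
  have a1 : q (n + t) (K f) ≤ ε / (|D n| + 1) * μ R * p (n + (r + t)) f
      + |C1| * μ (n + R) * p (r + t) f := by
    refine (h1 f).trans ?_
    rw [show n + t + r = n + (r + t) by omega]
    have := hμ (n + t + r₁)
    have := le_abs_self C1
    gcongr
  have a2 : q t (K f) ≤ (1 + |C2|) * μ R * p (r + t) f := by
    refine (h2 f).trans ?_
    rw [show t + r = r + t by omega]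
    have := hμ (t + r₁)
    have := le_abs_self C2
    calc 1 * μ r₁ * p (r + t) f + C2 * μ (t + r₁) * p r f
        ≤ 1 * μ R * p (r + t) f + |C2| * μ R * p (r + t) f := by gcongr
      _ = _ := by ring
  have a3 : (1 + μ (n + t₀)) * μ R ≤ (1 + M) * μ (n + R) := by
    have : μ (n + t₀) * μ R ≤ μ (n + R) * M := by gcongr
    linarith
  have a4 : (1 + μ (n + t₀)) * q t (K f) ≤ (1 + |C2|) * ((1 + M) * μ (n + R)) * p (r + t) f := by
    have := hμ (n + t₀)
    calc (1 + μ (n + t₀)) * q t (K f)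
        ≤ (1 + μ (n + t₀)) * ((1 + |C2|) * μ R * p (r + t) f) := by gcongr
      _ = (1 + |C2|) * ((1 + μ (n + t₀)) * μ R) * p (r + t) f := by ring
      _ ≤ _ := by gcongr
  have hX : 0 ≤ q (n + t) (K f) + (1 + μ (n + t₀)) * q t (K f) := by
    have := hμ (n + t₀)
    positivity
  have hDD : D n ≤ |D n| + 1 := by linarith [le_abs_self (D n)]
  calc s n (L (K f)) ≤ D n * (q (n + t) (K f) + (1 + μ (n + t₀)) * q t (K f)) := hL n (K f)
    _ ≤ (|D n| + 1) * (q (n + t) (K f) + (1 + μ (n + t₀)) * q t (K f)) := by gcongr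
    _ ≤ (|D n| + 1) * ((ε / (|D n| + 1) * μ R * p (n + (r + t)) f
      + |C1| * μ (n + R) * p (r + t) f)
      + (1 + |C2|) * ((1 + M) * μ (n + R)) * p (r + t) f) := by gcongr
    _ = _ := by field_simp; ring
end

section
/- Suppose K : E → F is tame of order r with data (r_0, (D_n)), L : F → G is μ-tamely small of order t with datum r_1, and μ_{r_0} ≤ M for some M ≥ 0. Assume in addition that K takes values in a finite-dimensional linear subspace H ⊆ F on which the seminorm q_0 is positive definite (i.e. q_0 restricted to H is a norm). Then for every n ∈ ℕ and every ε > 0 there is a constant C such that s_n(L(K f)) ≤ (ε·μ_{r_1} + C·μ_{n+r_1})·p_r(f) for all f ∈ E; in particular, L ∘ K is μ-tamely small of order r. (Lemma A.3(iii) of the paper, which rests on the fact that on the finite-dimensional space H every seminorm is bounded by a multiple of the norm q_0.) -/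
lemma seminorm_bound_aux {V : Type*} [NormedAddCommGroup V] [NormedSpace ℝ V]
    [FiniteDimensional ℝ V] (u : Seminorm ℝ V) :
    ∃ C : ℝ, 0 ≤ C ∧ ∀ x, u x ≤ C * ‖x‖ := by
  let b := Module.finBasis ℝ V
  refine ⟨∑ i, ‖LinearMap.toContinuousLinearMap (b.coord i)‖ * u (b i), 
    Finset.sum_nonneg fun i _ => mul_nonneg (norm_nonneg _) (apply_nonneg u _), fun x => ?_⟩
  have h1 : u x ≤ ∑ i, u (b.repr x i • b i) := by
    conv_lhs => rw [← b.sum_repr x]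
    exact Finset.le_sum_of_subadditive u (map_zero u).le (map_add_le_add u) _ _
  refine h1.trans ?_
  rw [Finset.sum_mul]
  refine Finset.sum_le_sum fun i _ => ?_
  rw [map_smul_eq_mul]
  have h2 := (LinearMap.toContinuousLinearMap (b.coord i)).le_opNorm x
  have h3 : ‖b.repr x i‖ ≤ ‖LinearMap.toContinuousLinearMap (b.coord i)‖ * ‖x‖ := by
    simpa using h2
  have := mul_le_mul_of_nonneg_right h3 (apply_nonneg u (b i))
  linarith

lemma seminorm_bound_aux2 {V : Type*} [AddCommGroup V] [Module ℝ V]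
    [FiniteDimensional ℝ V] (v u : Seminorm ℝ V) (hv : ∀ x, v x = 0 → x = 0) :
    ∃ C : ℝ, 0 ≤ C ∧ ∀ x, u x ≤ C * v x := by
  letI : Norm V := ⟨v⟩
  have core : NormedSpace.Core ℝ V :=
    { norm_nonneg := fun x => apply_nonneg v x
      norm_smul := fun c x => map_smul_eq_mul v c x
      norm_triangle := fun x y => map_add_le_add v x y
      norm_eq_zero_iff := fun x => ⟨hv x, fun h => by subst h; exact map_zero v⟩ }
  letI : NormedAddCommGroup V := NormedAddCommGroup.ofCore core
  letI : NormedSpace ℝ V := NormedSpace.ofCore core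
  exact seminorm_bound_aux u


/-- Lemma A.3(iii): if `K` is tame of order `r` with data `(r₀, D)`, `L` is `μ`-tamely
small of order `t` with datum `r₁`, `μ_{r₀} ≤ M`, and `K` takes values in a
finite-dimensional subspace `H` on which `q_0` is a norm, then for every `n` and `ε > 0`
there is `C` with `s_n (L (K f)) ≤ (ε μ_{r₁} + C μ_{n+r₁}) p_r f`; in particular
`L ∘ K` is `μ`-tamely small of order `r`. -/
theorem tame_comp_tamelySmall_finiteDim {E F G : Type*}
    [AddCommGroup E] [Module ℝ E] [AddCommGroup F] [Module ℝ F]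
    [AddCommGroup G] [Module ℝ G]
    (p : ℕ → Seminorm ℝ E) (q : ℕ → Seminorm ℝ F) (s : ℕ → Seminorm ℝ G)
    (hpmono : ∀ (n : ℕ) (f : E), p n f ≤ p (n + 1) f)
    (hqmono : ∀ (n : ℕ) (g : F), q n g ≤ q (n + 1) g)
    (hsmono : ∀ (n : ℕ) (g : G), s n g ≤ s (n + 1) g)
    (μ : ℕ → ℝ) (hμ : ∀ n, 0 ≤ μ n) (hμmono : Monotone μ)
    (K : E →ₗ[ℝ] F) (L : F →ₗ[ℝ] G)
    (r r₀ : ℕ) (D : ℕ → ℝ)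
    (hK : ∀ (n : ℕ) (f : E),
      q n (K f) ≤ D n * (p (n + r) f + (1 + μ (n + r₀)) * p r f))
    (t r₁ : ℕ)
    (hL : ∀ (n : ℕ), ∀ ε > (0 : ℝ), ∃ C : ℝ, ∀ g : F,
      s n (L g) ≤ ε * μ r₁ * q (n + t) g + C * μ (n + r₁) * q t g)
    (M : ℝ) (hM : 0 ≤ M) (hμM : μ r₀ ≤ M)
    (H : Submodule ℝ F) (hfin : FiniteDimensional ℝ H)
    (hKH : ∀ f : E, K f ∈ H)
    (hq0 : ∀ g ∈ H, q 0 g = 0 → g = 0) :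
    ∀ (n : ℕ), ∀ ε > (0 : ℝ), ∃ C : ℝ, ∀ f : E,
      s n (L (K f)) ≤ (ε * μ r₁ + C * μ (n + r₁)) * p r f := by


  have key : ∀ k, ∃ A : ℝ, 0 ≤ A ∧ ∀ f, q k (K f) ≤ A * p r f := by
    intro k
    obtain ⟨C, hC, hb⟩ := seminorm_bound_aux2 ((q 0).comp H.subtype) ((q k).comp H.subtype)
      (fun x hx => Subtype.ext (hq0 x x.2 hx))
    refine ⟨C * (|D 0| * (2 + M)), by positivity, fun f => ?_⟩
    have h1 : q k (K f) ≤ C * q 0 (K f) := hb ⟨K f, hKH f⟩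
    have h2 := hK 0 f
    rw [Nat.zero_add, Nat.zero_add] at h2
    have hp : 0 ≤ p r f := apply_nonneg _ _
    have h0 := hμ r₀
    have h3 : q 0 (K f) ≤ |D 0| * ((2 + M) * p r f) := by
      refine h2.trans (mul_le_mul (le_abs_self _) ?_ (by positivity) (abs_nonneg _))
      nlinarith
    calc q k (K f) ≤ C * q 0 (K f) := h1
      _ ≤ C * (|D 0| * ((2 + M) * p r f)) := mul_le_mul_of_nonneg_left h3 hC
      _ = _ := by ring
  intro n ε hε
  obtain ⟨A, hA, hAb⟩ := key (n + t)
  obtain ⟨B, hB, hBb⟩ := key t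
  obtain ⟨C, hC⟩ := hL n (ε / (A + 1)) (by positivity)
  refine ⟨|C| * B, fun f => ?_⟩
  have hp : 0 ≤ p r f := apply_nonneg _ _
  have hm1 := hμ r₁
  have hm2 := hμ (n + r₁)
  have hq : 0 ≤ q t (K f) := apply_nonneg _ _
  have e1 : ε / (A + 1) * A ≤ ε := by
    rw [div_mul_eq_mul_div, div_le_iff₀ (by positivity)]
    nlinarith
  calc s n (L (K f)) ≤ _ := hC (K f)
    _ ≤ ε / (A + 1) * μ r₁ * (A * p r f) + |C| * μ (n + r₁) * (B * p r f) := by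
      gcongr
      · exact hAb f
      · exact le_abs_self C
      · exact hBb f
    _ = (ε / (A + 1) * A) * (μ r₁ * p r f) + |C| * B * μ (n + r₁) * p r f := by ring
    _ ≤ ε * (μ r₁ * p r f) + |C| * B * μ (n + r₁) * p r f := by gcongr
    _ = _ := by ring
end

section
/- For all real-valued alternating 3-forms ρ and μ on V = ℂ³ (regarded as a 6-dimensional real vector space), one has Jρ ∧ μ = −ρ ∧ Jμ as real-valued alternating 6-forms on V. (This is the pointwise identity J γ ∧ μ = −γ ∧ J μ for 3-forms used in the proof of self-adjointness of the linearised operator, Lemma 3.2 [lemma-selfAdj] of the paper.) -/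
open scoped BigOperators

/-- `V = ℂ³` regarded as a (6-dimensional) real vector space. -/
abbrev VCY : Type := Fin 3 → ℂ

/-- The derivation `D` associated with multiplication by `i`:
`(Dρ)(v₁, v₂, v₃) = ρ(i v₁, v₂, v₃) + ρ(v₁, i v₂, v₃) + ρ(v₁, v₂, i v₃)`. -/
noncomputable def Dop (ρ : (Fin 3 → VCY) → ℝ) : (Fin 3 → VCY) → ℝ :=
  fun v => ∑ i : Fin 3, ρ (Function.update v i (Complex.I • v i))

/-- The operator `J = -(13/12) D - (1/12) D³` on real 3-forms, acting by `-i` on the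
`(3,0)` and `(2,1)` components and by `+i` on the `(1,2)` and `(0,3)` components. -/
noncomputable def Jop (ρ : (Fin 3 → VCY) → ℝ) : (Fin 3 → VCY) → ℝ :=
  fun v => -(13 / 12 : ℝ) * Dop ρ v - (1 / 12 : ℝ) * Dop (Dop (Dop ρ)) v

/-- Wedge product of two alternating 3-forms on `V`, as a 6-form, via the usual
antisymmetrization: `(α ∧ β)(v₁,…,v₆) = (1/(3!·3!)) ∑_{σ ∈ S₆} sgn(σ) α(v_{σ(1)}, v_{σ(2)},
v_{σ(3)}) β(v_{σ(4)}, v_{σ(5)}, v_{σ(6)})`. -/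
noncomputable def wedge33 (α β : (Fin 3 → VCY) → ℝ) : (Fin 6 → VCY) → ℝ :=
  fun v => (1 / 36 : ℝ) * ∑ σ : Equiv.Perm (Fin 6),
    ((Equiv.Perm.sign σ : ℤ) : ℝ) *
      (α (fun i => v (σ (Fin.castAdd 3 i))) * β (fun i => v (σ (Fin.natAdd 3 i))))

/-- Multiplication by `i` as a real-linear map. -/
noncomputable def JlinCY : VCY →ₗ[ℝ] VCY :=
  (LinearMap.lsmul ℂ VCY Complex.I).restrictScalars ℝ

theorem JlinCY_apply (x : VCY) : JlinCY x = Complex.I • x := rfl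

/-- The derivation induced by `i` on alternating `n`-forms. -/
noncomputable def DaltCY {n : ℕ} (ω : AlternatingMap ℝ VCY ℝ (Fin n)) :
    AlternatingMap ℝ VCY ℝ (Fin n) :=
  { (∑ i : Fin n, ω.toMultilinearMap.compLinearMap
      (Function.update (fun _ => LinearMap.id) i JlinCY)) with
    map_eq_zero_of_eq' := by
      intro v a b hab hne
      have key : ∀ i : Fin n, (fun j => (Function.update (fun _ => LinearMap.id) i JlinCY :
          Fin n → VCY →ₗ[ℝ] VCY) j (v j)) = Function.update v i (Complex.I • v i) := by
        intro i
        funext j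
        by_cases h : j = i
        · subst h; simp [JlinCY_apply]
        · simp [h]
      simp only [MultilinearMap.toFun_eq_coe, sum_apply,
        MultilinearMap.compLinearMap_apply, key, AlternatingMap.coe_multilinearMap]
      rw [Finset.sum_eq_add a b hne]
      · rw [← hab]
        have hs := ω.map_swap (Function.update v a (Complex.I • v a)) hne
        have : (Function.update v a (Complex.I • v a)) ∘ (Equiv.swap a b)
            = Function.update v b (Complex.I • v a) := by
          funext j
          by_cases hja : j = a
          · subst hja
            simp [hne, hne.symm, hab]
          · by_cases hjb : j = b
            · subst hjb; simp
            · simp [Equiv.swap_apply_of_ne_of_ne hja hjb, hja, hjb]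
        rw [this] at hs
        rw [hs]; simp
      · intro c _ hc
        apply ω.map_eq_zero_of_eq _ _ hne
        simp [hc.1.symm, hc.2.symm, hab]
      · simp
      · simp }

theorem DaltCY_apply {n : ℕ} (ω : AlternatingMap ℝ VCY ℝ (Fin n)) (v : Fin n → VCY) :
    DaltCY ω v = ∑ i, ω (Function.update v i (Complex.I • v i)) := by
  have key : ∀ i : Fin n, (fun j => (Function.update (fun _ => LinearMap.id) i JlinCY :
      Fin n → VCY →ₗ[ℝ] VCY) j (v j)) = Function.update v i (Complex.I • v i) := by
    intro i
    funext j
    by_cases h : j = i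
    · subst h; simp [JlinCY_apply]
    · simp [h]
  change (∑ i : Fin n, ω.toMultilinearMap.compLinearMap
      (Function.update (fun _ => LinearMap.id) i JlinCY)) v = _
  simp only [sum_apply,
    MultilinearMap.compLinearMap_apply, key, AlternatingMap.coe_multilinearMap]

theorem Dop_eq_DaltCY (ρ : AlternatingMap ℝ VCY ℝ (Fin 3)) :
    Dop (fun v => ρ v) = fun v => DaltCY ρ v := by
  funext v
  rw [DaltCY_apply]; rfl

/-- The standard real basis of `ℂ³`. -/
noncomputable def basisCY : Module.Basis (Σ _ : Fin 3, Fin 2) ℝ VCY :=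
  Pi.basis (fun _ => Complex.basisOneI)

theorem I_smul_basisCY (k : Σ _ : Fin 3, Fin 2) :
    ∃ (l : Σ _ : Fin 3, Fin 2) (c : ℝ), l ≠ k ∧ Complex.I • basisCY k = c • basisCY l := by
  obtain ⟨a, e⟩ := k
  fin_cases e
  · refine ⟨⟨a, 1⟩, 1, by simp, ?_⟩
    funext j
    by_cases h : j = a
    · subst h; simp [basisCY, Pi.basis_apply]
    · simp [basisCY, Pi.basis_apply, h]
  · refine ⟨⟨a, 0⟩, -1, by simp, ?_⟩
    funext j
    by_cases h : j = a
    · subst h; simp [basisCY, Pi.basis_apply]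
    · simp [basisCY, Pi.basis_apply, h]

/-- `i` is trace free, so its derivation kills top-degree forms. -/
theorem DaltCY_top (ω : AlternatingMap ℝ VCY ℝ (Fin 6)) : DaltCY ω = 0 := by
  refine Module.Basis.ext_alternating basisCY fun v hv => ?_
  have hsurj : Function.Surjective v :=
    ((Fintype.bijective_iff_injective_and_card v).2 ⟨hv, by simp⟩).2
  rw [DaltCY_apply, AlternatingMap.zero_apply]
  refine Finset.sum_eq_zero fun i _ => ?_
  obtain ⟨l, c, hl, h⟩ := I_smul_basisCY (v i)
  obtain ⟨j, rfl⟩ := hsurj l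
  have hji : j ≠ i := fun hh => hl (by rw [hh])
  rw [h, AlternatingMap.map_update_smul]
  rw [ω.map_eq_zero_of_eq _ _ hji]
  · simp
  · simp [hji]

/-- The unsymmetrized product of two 3-forms. -/
noncomputable def prodCY (α β : AlternatingMap ℝ VCY ℝ (Fin 3)) :
    MultilinearMap ℝ (fun _ : Fin 6 => VCY) ℝ :=
  (LinearMap.mul' ℝ ℝ).compMultilinearMap
    ((α.toMultilinearMap.domCoprod β.toMultilinearMap).domDomCongr
      (finSumFinEquiv : Fin 3 ⊕ Fin 3 ≃ Fin 6))

theorem prodCY_apply (α β : AlternatingMap ℝ VCY ℝ (Fin 3)) (v : Fin 6 → VCY) :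
    prodCY α β v = α (fun i => v (Fin.castAdd 3 i)) * β (fun i => v (Fin.natAdd 3 i)) := by
  simp only [prodCY, LinearMap.compMultilinearMap_apply, MultilinearMap.domDomCongr_apply,
    MultilinearMap.domCoprod_apply, LinearMap.mul'_apply]
  rfl

theorem wedge33_eq (α β : AlternatingMap ℝ VCY ℝ (Fin 3)) (v : Fin 6 → VCY) :
    wedge33 (fun v => α v) (fun v => β v) v
      = (1 / 36 : ℝ) * MultilinearMap.alternatization (prodCY α β) v := by
  rw [MultilinearMap.alternatization_apply, wedge33]
  congr 1
  refine Finset.sum_congr rfl fun σ _ => ?_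
  rw [MultilinearMap.domDomCongr_apply, prodCY_apply,
    Units.smul_def, zsmul_eq_mul]

theorem prodCY_D (α β : AlternatingMap ℝ VCY ℝ (Fin 3)) (w : Fin 6 → VCY) :
    ∑ k, prodCY α β (Function.update w k (Complex.I • w k))
      = prodCY (DaltCY α) β w + prodCY α (DaltCY β) w := by
  have hc : ∀ k i : Fin 3, Fin.castAdd 3 i = Fin.castAdd 3 k ↔ i = k := by decide
  have hn : ∀ k i : Fin 3, Fin.natAdd 3 i = Fin.natAdd 3 k ↔ i = k := by decide
  have hcn : ∀ k i : Fin 3, Fin.castAdd 3 i ≠ Fin.natAdd 3 k := by decide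
  rw [show (∑ k : Fin 6, prodCY α β (Function.update w k (Complex.I • w k))) =
    ∑ k : Fin (3 + 3), prodCY α β (Function.update w k (Complex.I • w k)) from rfl,
    Fin.sum_univ_add]
  simp only [prodCY_apply, DaltCY_apply, Finset.sum_mul, Finset.mul_sum]
  congr 1
  · refine Finset.sum_congr rfl fun k _ => ?_
    congr 2
    · funext i
      simp only [Function.update_apply, hc]
    · funext i
      exact Function.update_of_ne (hcn i k).symm _ _
  · refine Finset.sum_congr rfl fun k _ => ?_
    congr 2
    · funext i
      exact Function.update_of_ne (hcn k i) _ _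
    · funext i
      simp only [Function.update_apply, hn]

theorem wedge33_D (α β : AlternatingMap ℝ VCY ℝ (Fin 3)) (v : Fin 6 → VCY) :
    wedge33 (fun v => DaltCY α v) (fun v => β v) v
      = - wedge33 (fun v => α v) (fun v => DaltCY β v) v := by
  have h0 : DaltCY (MultilinearMap.alternatization (prodCY α β)) v = 0 := by
    rw [DaltCY_top]; rfl
  have h1 : DaltCY (MultilinearMap.alternatization (prodCY α β)) v
      = MultilinearMap.alternatization (prodCY (DaltCY α) β) v
        + MultilinearMap.alternatization (prodCY α (DaltCY β)) v := by
    rw [DaltCY_apply]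
    simp only [MultilinearMap.alternatization_apply]
    rw [Finset.sum_comm, ← Finset.sum_add_distrib]
    refine Finset.sum_congr rfl fun σ _ => ?_
    simp only [MultilinearMap.domDomCongr_apply]
    rw [← Finset.smul_sum, ← smul_add, ← prodCY_D, ← Equiv.sum_comp σ]
    congr 1
    refine Finset.sum_congr rfl fun k _ => ?_
    congr 1
    funext i
    simp only [Function.update_apply, EmbeddingLike.apply_eq_iff_eq]
  rw [wedge33_eq, wedge33_eq]
  linear_combination (1 / 36 : ℝ) * (h0 - h1)

theorem wedge33_comb_left (a b : ℝ) (f g h : (Fin 3 → VCY) → ℝ) (v : Fin 6 → VCY) :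
    wedge33 (fun v => a * f v - b * g v) h v = a * wedge33 f h v - b * wedge33 g h v := by
  simp only [wedge33, Finset.mul_sum, ← Finset.sum_sub_distrib]
  exact Finset.sum_congr rfl fun σ _ => by ring

theorem wedge33_comb_right (a b : ℝ) (f g h : (Fin 3 → VCY) → ℝ) (v : Fin 6 → VCY) :
    wedge33 h (fun v => a * f v - b * g v) v = a * wedge33 h f v - b * wedge33 h g v := by
  simp only [wedge33, Finset.mul_sum, ← Finset.sum_sub_distrib]
  exact Finset.sum_congr rfl fun σ _ => by ring

/-- The identity `Jρ ∧ μ = -ρ ∧ Jμ` for real alternating 3-forms on `ℂ³`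
(used in the proof of self-adjointness of the linearised operator). -/
theorem Jwedge_antisymm (ρ μ : AlternatingMap ℝ VCY ℝ (Fin 3)) :
    wedge33 (Jop fun v => ρ v) (fun v => μ v)
      = - wedge33 (fun v => ρ v) (Jop fun v => μ v) := by
  funext v
  rw [Pi.neg_apply]
  have hJ : ∀ ρ : AlternatingMap ℝ VCY ℝ (Fin 3), (Jop fun v => ρ v) = fun v =>
      -(13 / 12 : ℝ) * DaltCY ρ v - (1 / 12 : ℝ) * DaltCY (DaltCY (DaltCY ρ)) v := by
    intro ρ
    funext v
    rw [Jop, Dop_eq_DaltCY, Dop_eq_DaltCY, Dop_eq_DaltCY]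
  rw [hJ, hJ, wedge33_comb_left, wedge33_comb_right, wedge33_D, wedge33_D, wedge33_D, wedge33_D]
  ring
end
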